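/- For every T ∈ 𝒯(s), the tableau D_{2,s}(T) satisfies Criterion 1; that is, D_{2,s}(T) ∈ ⋃_{k=0}^{s} B(kϖ₂). -/

import Mathlib

namespace KR

/-- A letter of the type `Dₙ` alphabet: `pos i` is the unbarred letter `i`
(1-based, valid when `1 ≤ i ≤ n`), `neg i` is the barred letter `ī`. -/
inductive Letter : Type
  | pos : ℕ → Letter
  | neg : ℕ → Letter
deriving DecidableEq

namespace Letter

/-- The bar involution. -/
def bar : Letter → Letter
  | pos i => neg i
  | neg i => pos i

/-- Validity of a letter for the alphabet of type `Dₙ`. -/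
def valid (n : ℕ) : Letter → Prop
  | pos i => 1 ≤ i ∧ i ≤ n
  | neg i => 1 ≤ i ∧ i ≤ n

/-- The partial order `1 < 2 < ⋯ < n-1 < n, n̄ < ⋯ < 2̄ < 1̄`
with `n` and `n̄` incomparable. -/
def le (n : ℕ) : Letter → Letter → Prop
  | pos i, pos j => i ≤ j
  | neg i, neg j => j ≤ i
  | pos i, neg j => ¬ (i = n ∧ j = n)
  | neg _, pos _ => False

end Letter

/-- A column `(a over b)` of a two-row tableau: `c.1` is the top letter,
`c.2` the bottom letter.  A tableau of shape `(k,k)` is a list of `k` columns. -/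
abbrev Col := Letter × Letter

def colValid (n : ℕ) (c : Col) : Prop := c.1.valid n ∧ c.2.valid n

/-- Criterion 1, condition (1): both rows weakly increasing. -/
def cond1 (n : ℕ) (T : List Col) : Prop :=
  List.Chain' (fun c d : Col => Letter.le n c.1 d.1 ∧ Letter.le n c.2 d.2) T

/-- Criterion 1, condition (2): in every column `(a over b)`, `b ≰ a`. -/
def cond2 (n : ℕ) (T : List Col) : Prop := ∀ c ∈ T, ¬ Letter.le n c.2 c.1

/-- Criterion 1, condition (3): no adjacent columns `(a|x)(a|ā)` or `(a|ā)(y|ā)`. -/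
def cond3 (T : List Col) : Prop :=
  List.Chain' (fun c d : Col =>
    ¬ (c.1 = d.1 ∧ d.2 = d.1.bar) ∧ ¬ (c.2 = c.1.bar ∧ d.2 = c.2)) T

/-- Criterion 1, condition (4): no (possibly non-adjacent) pair of columns
`(n-1|n) … (n|‾(n-1))` in that order, nor `(n-1|n̄) … (n̄|‾(n-1))`. -/
def cond4 (n : ℕ) (T : List Col) : Prop :=
  (¬ ∃ i j : ℕ, i < j ∧ T[i]? = some (Letter.pos (n-1), Letter.pos n) ∧
      T[j]? = some (Letter.pos n, Letter.neg (n-1))) ∧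
  (¬ ∃ i j : ℕ, i < j ∧ T[i]? = some (Letter.pos (n-1), Letter.neg n) ∧
      T[j]? = some (Letter.neg n, Letter.neg (n-1)))

/-- Criterion 1, condition (5): no column `(1 over 1̄)`. -/
def cond5 (T : List Col) : Prop := (Letter.pos 1, Letter.neg 1) ∉ T

/-- `B(kϖ₂)`: tableaux of shape `(k,k)` satisfying Criterion 1. -/
def BB (n k : ℕ) : Set (List Col) :=
  {T | T.length = k ∧ (∀ c ∈ T, colValid n c) ∧ cond1 n T ∧ cond2 n T ∧
       cond3 T ∧ cond4 n T ∧ cond5 T}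

/-- `𝒯(s)`: tableaux of shape `(s,s)` satisfying conditions (1), (2), (4). -/
def TT (n s : ℕ) : Set (List Col) :=
  {T | T.length = s ∧ (∀ c ∈ T, colValid n c) ∧ cond1 n T ∧ cond2 n T ∧ cond4 n T}

/-- A letter `a ∈ {1, …, n, n̄}`. -/
def aLetter (n : ℕ) : Letter → Prop
  | .pos i => 1 ≤ i ∧ i ≤ n
  | .neg i => i = n

/-- The column `(1 over 1̄)`. -/
def oneBarOne : Col := (Letter.pos 1, Letter.neg 1)

/-- `T` contains a maximal nonempty block of `m` consecutive columns `(a over ā)`,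
with prefix `L` and suffix `R`. -/
def maxBlock (T : List Col) (a : Letter) (m : ℕ) (L R : List Col) : Prop :=
  0 < m ∧ T = L ++ List.replicate m (a, a.bar) ++ R ∧
  (∀ c, L.getLast? = some c → c ≠ (a, a.bar)) ∧
  (∀ c, R.head? = some c → c ≠ (a, a.bar))

/-- The drop map `D_{2,s}` as a relation: `DropRel n s T T'` holds when `T'` is the
result of applying `D_{2,s}` to `T`. -/
def DropRel (n s : ℕ) (T T' : List Col) : Prop :=
  (T = List.replicate s oneBarOne ∧ T' = []) ∨
  (T ∈ BB n s ∧ T' = T) ∨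
  (T ≠ List.replicate s oneBarOne ∧ T ∉ BB n s ∧
    ∃ a m L R, aLetter n a ∧ maxBlock T a m L R ∧ T' = L ++ R)

/-- Criterion 2 at the (0-based) adjacent pair `(t[i], t[i+1])`:
`bᵢ ≤ āᵢ ≤ b_{i+1}` or `aᵢ ≤ ‾b_{i+1} ≤ a_{i+1}` (paper position `i+1`). -/
def crit2At (n : ℕ) (t : List Col) (i : ℕ) : Prop :=
  ∃ c d : Col, t[i]? = some c ∧ t[i+1]? = some d ∧
    ((Letter.le n c.2 c.1.bar ∧ Letter.le n c.1.bar d.2) ∨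
     (Letter.le n c.1 d.2.bar ∧ Letter.le n d.2.bar d.1))

/-- `i` is a filling location of `t` (paper indexing: `1 ≤ i ≤ k-1` interior,
`i = k` appending, `i = 0` prepending). -/
def isFillingLoc (n s : ℕ) (t : List Col) (i : ℕ) : Prop :=
  (1 ≤ i ∧ i + 1 ≤ t.length ∧ crit2At n t (i-1)) ∨
  (i = t.length ∧ 0 < t.length ∧ (∀ j, ¬ crit2At n t j) ∧
    ∃ c : Col, t.getLast? = some c ∧
      t ++ List.replicate (s - t.length) (c.1, c.1.bar) ∈ TT n s) ∨
  (i = 0 ∧ 0 < t.length ∧ (∀ j, ¬ crit2At n t j) ∧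
    ∃ c : Col, t.head? = some c ∧
      List.replicate (s - t.length) (c.2.bar, c.2) ++ t ∈ TT n s)

/-- `T` is a result of filling `t` at location `i` (inserting `s - k` columns). -/
def fillAtRel (n s : ℕ) (t : List Col) (i : ℕ) (T : List Col) : Prop :=
  (1 ≤ i ∧ i + 1 ≤ t.length ∧
    ∃ c d : Col, t[i-1]? = some c ∧ t[i]? = some d ∧
      ((Letter.le n c.2 c.1.bar ∧ Letter.le n c.1.bar d.2 ∧
         T = t.take i ++ List.replicate (s - t.length) (c.1, c.1.bar) ++ t.drop i) ∨
       (Letter.le n c.1 d.2.bar ∧ Letter.le n d.2.bar d.1 ∧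
         T = t.take i ++ List.replicate (s - t.length) (d.2.bar, d.2) ++ t.drop i))) ∨
  (i = t.length ∧ 0 < t.length ∧ (∀ j, ¬ crit2At n t j) ∧
    ∃ c : Col, t.getLast? = some c ∧
      T = t ++ List.replicate (s - t.length) (c.1, c.1.bar)) ∨
  (i = 0 ∧ 0 < t.length ∧ (∀ j, ¬ crit2At n t j) ∧
    ∃ c : Col, t.head? = some c ∧
      T = List.replicate (s - t.length) (c.2.bar, c.2) ++ t)

/-- The fill map `F_{2,s}` as a relation. -/
def FillRel (n s : ℕ) (t T : List Col) : Prop :=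
  (t.length = s ∧ T = t) ∨
  (t = [] ∧ T = List.replicate s oneBarOne) ∨
  (t ≠ [] ∧ t.length < s ∧ ∃ i, isFillingLoc n s t i ∧ fillAtRel n s t i T)

/-- `T` contains an `a`-configuration of size `m` (one of the three types of
Proposition `ablock`). -/
def hasAConfig (T : List Col) (a : Letter) (m : ℕ) : Prop :=
  (∃ L R : List Col, ∃ b c d : Letter, b ≠ a.bar ∧ (c ≠ a ∨ d ≠ a.bar) ∧
     T = L ++ [(a, b)] ++ List.replicate m (a, a.bar) ++ [(c, d)] ++ R) ∨
  (∃ L R : List Col, ∃ b c d : Letter, d ≠ a ∧ (b ≠ a ∨ c ≠ a.bar) ∧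
     T = L ++ [(b, c)] ++ List.replicate m (a, a.bar) ++ [(d, a.bar)] ++ R) ∨
  (∃ L R : List Col, ∃ b c d e : Letter, b ≠ a ∧ e ≠ a.bar ∧
     T = L ++ [(b, c)] ++ List.replicate (m+1) (a, a.bar) ++ [(d, e)] ++ R)

/-- The row relation together with validity of both columns. -/
def RV (n : ℕ) (c d : Col) : Prop :=
  colValid n c ∧ colValid n d ∧ Letter.le n c.1 d.1 ∧ Letter.le n c.2 d.2

theorem le_trans_valid {n : ℕ} {x y z : Letter} (hx : x.valid n) (hy : y.valid n)
    (hz : z.valid n) (h1 : Letter.le n x y) (h2 : Letter.le n y z) : Letter.le n x z := by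
  cases x <;> cases y <;> cases z <;> simp only [Letter.le, Letter.valid] at * <;> omega

theorem le_antisymm_valid {n : ℕ} {x y : Letter}
    (h1 : Letter.le n x y) (h2 : Letter.le n y x) : x = y := by
  cases x <;> cases y <;> simp only [Letter.le, Letter.pos.injEq, Letter.neg.injEq] at * <;> omega

instance (n : ℕ) : IsTrans Col (RV n) where
  trans _ _ _ h1 h2 :=
    ⟨h1.1, h2.2.1, le_trans_valid h1.1.1 h1.2.1.1 h2.2.1.1 h1.2.2.1 h2.2.2.1,
      le_trans_valid h1.1.2 h1.2.1.2 h2.2.1.2 h1.2.2.2 h2.2.2.2⟩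

theorem RV_antisymm {n : ℕ} {c d : Col} (h1 : RV n c d) (h2 : RV n d c) : c = d :=
  Prod.ext (le_antisymm_valid h1.2.2.1 h2.2.2.1) (le_antisymm_valid h1.2.2.2 h2.2.2.2)

/-- Two comparable columns of the form `(x over bar x)` coincide. -/
theorem bar_unique {n : ℕ} {x y : Letter} (h : RV n (x, x.bar) (y, y.bar))
    (hx : ¬ Letter.le n x.bar x) (hy : ¬ Letter.le n y.bar y) : x = y := by
  obtain ⟨⟨h1, -⟩, ⟨h2, -⟩, h3, h4⟩ := h
  cases x <;> cases y <;> simp only [Letter.le, Letter.bar, Letter.valid, Letter.pos.injEq,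
    Letter.neg.injEq] at * <;> omega

theorem pairwise_RV {n : ℕ} {T : List Col} (hv : ∀ c ∈ T, colValid n c) (h : cond1 n T) :
    T.Pairwise (RV n) := by
  rw [← List.isChain_iff_pairwise]
  unfold cond1 List.Chain' at h
  induction T with
  | nil => simp
  | cons c T ih =>
    cases T with
    | nil => simp
    | cons d T =>
      rw [List.isChain_cons_cons] at h ⊢
      exact ⟨⟨hv c (by simp), hv d (by simp), h.1⟩,
        ih (fun e he => hv e (List.mem_cons_of_mem _ he)) h.2⟩

theorem pair_sublist {x y : Col} {T T' : List Col} (hs : T'.Sublist T)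
    (h : ¬ ∃ i j : ℕ, i < j ∧ T[i]? = some x ∧ T[j]? = some y) :
    ¬ ∃ i j : ℕ, i < j ∧ T'[i]? = some x ∧ T'[j]? = some y := by
  have key : ∀ l : List Col, (¬ ∃ i j : ℕ, i < j ∧ l[i]? = some x ∧ l[j]? = some y) ↔
      l.Pairwise (fun c d => ¬ (c = x ∧ d = y)) := by
    intro l
    rw [List.pairwise_iff_getElem]
    constructor
    · intro h i j hi hj hij hxy
      exact h ⟨i, j, hij, by rw [List.getElem?_eq_getElem hi, hxy.1],
        by rw [List.getElem?_eq_getElem hj, hxy.2]⟩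
    · rintro h ⟨i, j, hij, h1, h2⟩
      obtain ⟨hi, h1⟩ := List.getElem?_eq_some_iff.1 h1
      obtain ⟨hj, h2⟩ := List.getElem?_eq_some_iff.1 h2
      exact h i j hi hj hij ⟨h1, h2⟩
  rw [key] at h ⊢
  exact h.sublist hs

theorem isChain_of_pairwise_mem {R : Col → Col → Prop} {T : List Col}
    (h : ∀ c ∈ T, ∀ d ∈ T, R c d) : T.IsChain R :=
  (List.pairwise_of_forall_mem_list h).isChain

/-- After removing a maximal block no column `(x over bar x)` is left. -/
theorem no_bar {n m : ℕ} {T L R : List Col} {a : Letter} (hp : T.Pairwise (RV n))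
    (h2 : cond2 n T) (hb : maxBlock T a m L R) (x : Letter) : (x, x.bar) ∉ L ++ R := by
  obtain ⟨hm, rfl, hL, hR⟩ := hb
  have ha : (a, a.bar) ∈ List.replicate m (a, a.bar) := List.mem_replicate.2 ⟨by omega, rfl⟩
  have ha2 : ¬ Letter.le n a.bar a := h2 (a, a.bar) (by simp only [List.mem_append]; tauto)
  rw [List.pairwise_append, List.pairwise_append] at hp
  obtain ⟨⟨pL, -, pLB⟩, pR, pBR⟩ := hp
  intro hx
  have hx2 : ¬ Letter.le n x.bar x := h2 (x, x.bar) (by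
    simp only [List.mem_append] at hx ⊢; tauto)
  rcases List.mem_append.1 hx with hx | hx
  · obtain rfl := bar_unique (pLB _ hx _ ha) hx2 ha2
    rcases List.eq_nil_or_concat L with rfl | ⟨L', z, rfl⟩
    · simp at hx
    · have hz : z ≠ (x, x.bar) := hL z (by simp)
      rw [List.concat_eq_append, List.pairwise_append] at pL
      have hx' : (x, x.bar) ∈ L' := by
        simp only [List.concat_eq_append, List.mem_append, List.mem_singleton] at hx
        exact hx.resolve_right (fun h => hz h.symm)
      exact hz (RV_antisymm (pLB z (by simp) _ ha) (pL.2.2 _ hx' z (by simp)))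
  · obtain rfl := bar_unique (pBR _ (List.mem_append_right _ ha) _ hx) ha2 hx2
    cases R with
    | nil => simp at hx
    | cons z R' =>
      have hz : z ≠ (a, a.bar) := hR z (by simp)
      have hx' : (a, a.bar) ∈ R' := (List.mem_cons.1 hx).resolve_left (fun h => hz h.symm)
      exact hz (RV_antisymm ((List.pairwise_cons.1 pR).1 _ hx')
        (pBR _ (List.mem_append_right _ ha) z (by simp)))

/-- For every `T ∈ 𝒯(s)`, the result of the drop map `D_{2,s}`
satisfies Criterion 1, i.e. lies in `⋃_{k=0}^{s} B(kϖ₂)`. -/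
theorem drop_mem_BB (n s : ℕ) (hn : 4 ≤ n) (hs : 1 ≤ s) (T T' : List Col)
    (hT : T ∈ TT n s) (h : DropRel n s T T') :
    ∃ k, k ≤ s ∧ T' ∈ BB n k := by
  obtain ⟨hlen, hv, h1, h2, h4⟩ := hT
  rcases h with ⟨-, rfl⟩ | ⟨h, rfl⟩ | ⟨-, -, a, m, L, R, -, hb, rfl⟩
  · exact ⟨0, Nat.zero_le _, by simp [BB, List.Chain', cond1, cond2, cond3, cond4, cond5]⟩
  · exact ⟨s, le_rfl, h⟩
  · have hp := pairwise_RV hv h1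
    have hno := no_bar hp h2 hb
    have hsub : (L ++ R).Sublist T := by
      rw [hb.2.1]
      exact (List.sublist_append_left _ _).append (List.Sublist.refl _)
    refine ⟨(L ++ R).length, hlen ▸ hsub.length_le, rfl, fun c hc => hv c (hsub.subset hc),
      ?_, fun c hc => h2 c (hsub.subset hc), ?_, ?_, hno (Letter.pos 1)⟩
    · exact (hp.sublist hsub).isChain.imp (fun _ _ h => h.2.2)
    · refine isChain_of_pairwise_mem fun c hc d hd => ⟨?_, ?_⟩
      · rintro ⟨-, h⟩
        exact hno d.1 (by rw [← h]; exact hd)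
      · rintro ⟨h, -⟩
        exact hno c.1 (by rw [← h]; exact hc)
    · exact ⟨pair_sublist hsub h4.1, pair_sublist hsub h4.2⟩

end KR
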